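/- Let n ∈ ℕ₊ be even. There exists a constant C = C(d, σ, n) > 0 such that for every probability space (Ω, ℱ, ℙ), every strongly measurable random field ζ : Ω → L^n(𝕋) and every μ ∈ (0, 1/2], it holds 𝔼 ‖(𝐓 K_μ^{*d}) ⋆ ζ‖_{L^∞(𝕋)}^n ≤ C [μ]^{−d} 𝔼 ‖ζ‖_{L^n(𝕋)}^n, where ⋆ denotes convolution on the torus 𝕋. -/

import Mathlib

open MeasureTheory ENNReal Real

/-- The kernel `K_μ` (density, valued in `[0,∞]`). -/
noncomputable def Kker (d : ℕ) (σ μ : ℝ) (x : Fin d → ℝ) : ℝ≥0∞ :=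
  ∫⁻ t in Set.Ioi (0 : ℝ), ENNReal.ofReal
    (Real.exp (-t) * (4 * π * t * μ ^ ((2 : ℝ) / σ)) ^ (-(d : ℝ) / 2) *
      Real.exp (-(∑ i, x i ^ 2) / (4 * t * μ ^ ((2 : ℝ) / σ))))

/-- The kernel `K_μ` as a measure on `ℝ^d`. -/
noncomputable def Kmeas (d : ℕ) (σ μ : ℝ) : Measure (Fin d → ℝ) :=
  volume.withDensity (Kker d σ μ)

/-- Convolution powers `K_μ^{*g}` as measures; `K_μ^{*0} = δ₀`. -/
noncomputable def Kpow (d : ℕ) (σ μ : ℝ) : ℕ → Measure (Fin d → ℝ)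
  | 0 => Measure.dirac 0
  | g + 1 => (Kmeas d σ μ).conv (Kpow d σ μ g)

/-- Convolution of a measure with a function: `(ρ ∗ f)(x) = ∫ f(x−z) ρ(dz)`.
For a `2π`-periodic `f` this realizes the torus convolution `𝐓(K) ⋆ f`. -/
noncomputable def measConv (d : ℕ) (ρ : Measure (Fin d → ℝ)) (f : (Fin d → ℝ) → ℝ) :
    (Fin d → ℝ) → ℝ := fun x => ∫ z, f (x - z) ∂ρ

/-- The box `[0,2π)^d`, a fundamental domain of the torus `𝕋 = ℝ^d/(2πℤ)^d`. -/
def box (d : ℕ) : Set (Fin d → ℝ) := Set.univ.pi fun _ => Set.Ico 0 (2 * π)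

theorem lintegral_fin_prod_eq_prod {d : ℕ} {f : ℝ → ℝ≥0∞} (hf : Measurable f) :
    ∫⁻ x : Fin d → ℝ, ∏ i, f (x i) = (∫⁻ x, f x) ^ d := by
  induction d with
  | zero => simp [volume_pi]
  | succ d ih =>
    have e := (volume_preserving_piFinSuccAbove (fun _ : Fin (d + 1) => ℝ) 0).symm
    rw [← e.lintegral_comp (by fun_prop)]
    simp_rw [MeasurableEquiv.piFinSuccAbove_symm_apply, Fin.insertNthEquiv,
      Fin.prod_univ_succ, Fin.insertNth_zero, Equiv.coe_fn_mk, Fin.cons_succ, Fin.cons_zero, cast_eq]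
    rw [Measure.volume_eq_prod, lintegral_prod_mul (f := f)
      (g := fun y : Fin d → ℝ => ∏ i, f (y i)) hf.aemeasurable
      (Finset.measurable_prod _ fun i _ => hf.comp (measurable_pi_apply i)).aemeasurable, ih, pow_succ']

theorem tsum_fin_prod_eq_prod {d : ℕ} (f : Fin d → ℤ → ℝ≥0∞) :
    ∑' k : Fin d → ℤ, ∏ i, f i (k i) = ∏ i, ∑' k, f i k := by
  induction d with
  | zero => simp
  | succ d ih =>
    rw [← (Fin.consEquiv fun _ : Fin (d + 1) => ℤ).tsum_eq, ENNReal.tsum_prod']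
    simp only [Fin.consEquiv_apply, Fin.prod_univ_succ, Fin.cons_zero, Fin.cons_succ,
      ENNReal.tsum_mul_left, ih fun i => f i.succ, ENNReal.tsum_mul_right]

/-- The embedding of `ℤ^d` in `ℝ^d` as the lattice `(2πℤ)^d`. -/
noncomputable def latticeHom (d : ℕ) : (Fin d → ℤ) →+ (Fin d → ℝ) where
  toFun k i := 2 * π * (k i : ℝ)
  map_zero' := by ext; simp
  map_add' k l := by ext; simp [mul_add]

theorem latticeHom_injective (d : ℕ) : Function.Injective (latticeHom d) := by
  intro k l h
  ext i
  have := congrFun h i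
  simpa [latticeHom, pi_ne_zero] using this

theorem existsUnique_add_latticeHom_mem_box (d : ℕ) (x : Fin d → ℝ) :
    ∃! k, latticeHom d k + x ∈ box d := by
  have key : ∀ k, latticeHom d k + x ∈ box d ↔ ∀ i, k i = toIcoDiv two_pi_pos 0 (x i) * (-1) := by
    intro k
    simp only [box, Set.mem_pi, Set.mem_univ, true_imp_iff]
    refine forall_congr' fun i => ?_
    constructor
    · intro h
      have := toIcoDiv_eq_of_sub_zsmul_mem_Ico (hp := two_pi_pos) (a := 0) (b := x i) (n := -(k i))
        (by simpa [latticeHom, mul_comm, add_comm] using h)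
      omega
    · intro h
      have := sub_toIcoDiv_zsmul_mem_Ico two_pi_pos 0 (x i)
      simpa [latticeHom, h, mul_comm, add_comm, sub_eq_add_neg] using this
  refine ⟨fun i => toIcoDiv two_pi_pos 0 (x i) * (-1), (key _).2 fun _ => rfl, fun k hk => ?_⟩
  ext i
  exact (key k).1 hk i

theorem measurableSet_box (d : ℕ) : MeasurableSet (box d) :=
  MeasurableSet.univ_pi fun _ => measurableSet_Ico

theorem isAddFundamentalDomain_box (d : ℕ) :
    IsAddFundamentalDomain (latticeHom d).range (box d) := by
  refine .mk' (measurableSet_box d).nullMeasurableSet fun x => ?_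
  obtain ⟨k, hk, hu⟩ := existsUnique_add_latticeHom_mem_box d x
  refine ⟨⟨latticeHom d k, k, rfl⟩, hk, ?_⟩
  rintro ⟨_, l, rfl⟩ hl
  exact Subtype.ext (congrArg (latticeHom d) (hu l hl))

theorem isAddFundamentalDomain_sub_box (d : ℕ) (x : Fin d → ℝ) :
    IsAddFundamentalDomain (latticeHom d).range ((fun z => x - z) ⁻¹' box d) := by
  refine .mk' ((measurableSet_box d).preimage (by fun_prop)).nullMeasurableSet fun y => ?_
  obtain ⟨k, hk, hu⟩ := existsUnique_add_latticeHom_mem_box d (x - y)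
  have e : ∀ l, x - (latticeHom d l + y) = latticeHom d (-l) + (x - y) := by
    intro l; rw [map_neg]; abel
  refine ⟨⟨latticeHom d (-k), -k, rfl⟩, ?_, ?_⟩
  · change x - (latticeHom d (-k) + y) ∈ box d
    rwa [e, neg_neg]
  · rintro ⟨_, l, rfl⟩ hl
    have hl' : x - (latticeHom d l + y) ∈ box d := hl
    rw [e] at hl'
    refine Subtype.ext (congrArg (latticeHom d) ?_)
    rw [← hu _ hl', neg_neg]

instance (d : ℕ) : Countable (latticeHom d).range :=
  (latticeHom d).rangeRestrict_surjective.countable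

/-- Invariance under translation by the lattice `(2πℤ)^d`. -/
def LatticePeriodic {d : ℕ} {α : Type*} (h : (Fin d → ℝ) → α) : Prop :=
  ∀ x k, h (x + latticeHom d k) = h x

theorem LatticePeriodic.setLIntegral_sub {d : ℕ} {h : (Fin d → ℝ) → ℝ≥0∞}
    (hp : LatticePeriodic h) (x : Fin d → ℝ) :
    ∫⁻ z in box d, h (x - z) = ∫⁻ z in box d, h z := by
  have e := (Measure.measurePreserving_sub_left volume x).setLIntegral_comp_preimage_emb
    (MeasurableEquiv.subLeft x).measurableEmbedding h ((fun z => x - z) ⁻¹' box d)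
  have hs : (fun z => x - z) ⁻¹' ((fun z => x - z) ⁻¹' box d) = box d := by
    ext; simp
  rw [hs] at e
  rw [e]
  refine (isAddFundamentalDomain_sub_box d x).setLIntegral_eq (isAddFundamentalDomain_box d) h ?_
  rintro ⟨_, k, rfl⟩ y
  change h (latticeHom d k + y) = h y
  rw [add_comm, hp]

/-- A periodic function integrated against a density whose periodization is at most `M`. -/
theorem LatticePeriodic.lintegral_mul_le {d : ℕ} {h p : (Fin d → ℝ) → ℝ≥0∞}
    (hp : LatticePeriodic h) (hm : Measurable h) (hpm : Measurable p) {M : ℝ≥0∞}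
    (hM : ∀ z ∈ box d, ∑' k, p (latticeHom d k + z) ≤ M) (x : Fin d → ℝ) :
    ∫⁻ z, p z * h (x - z) ≤ M * ∫⁻ z in box d, h z := by
  rw [(isAddFundamentalDomain_box d).lintegral_eq_tsum'',
    ← ((latticeHom d).ofInjective (latticeHom_injective d)).toEquiv.tsum_eq]
  change ∑' k, ∫⁻ z in box d, p (latticeHom d k + z) * h (x - (latticeHom d k + z)) ≤ _
  have e : ∀ k z, h (x - (latticeHom d k + z)) = h (x - z) := by
    intro k z
    rw [← hp (x - z) (-k), map_neg]
    congr 1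
    abel
  simp_rw [e]
  rw [← lintegral_tsum (fun k => by fun_prop), ← hp.setLIntegral_sub x,
    ← lintegral_const_mul _ (by fun_prop)]
  refine setLIntegral_mono (by fun_prop) fun z hz => ?_
  rw [ENNReal.tsum_mul_right]
  gcongr
  exact hM z hz

theorem summable_exp_neg_mul_int_sq {a : ℝ} (ha : 0 < a) :
    Summable fun n : ℤ => Real.exp (-a * (n : ℝ) ^ 2) := by
  have h : Summable fun n : ℕ => Real.exp (-a * (n : ℝ) ^ 2) := by
    refine .of_nonneg_of_le (fun _ => (Real.exp_pos _).le) (fun n => ?_)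
      (Real.summable_exp_nat_mul_iff.2 (neg_lt_zero.2 ha))
    have : (n : ℝ) ≤ (n : ℝ) ^ 2 := by exact_mod_cast Nat.le_self_pow two_ne_zero n
    exact Real.exp_le_exp.2 (by nlinarith)
  exact .of_nat_of_neg (by simpa using h) (by simpa using h)

theorem tsum_exp_neg_mul_int_sq_anti {a b : ℝ} (ha : 0 < a) (hab : a ≤ b) :
    ∑' n : ℤ, Real.exp (-b * (n : ℝ) ^ 2) ≤ ∑' n : ℤ, Real.exp (-a * (n : ℝ) ^ 2) :=
  (summable_exp_neg_mul_int_sq (ha.trans_le hab)).tsum_le_tsum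
    (fun n => Real.exp_le_exp.2 (by nlinarith [sq_nonneg (n : ℝ)])) (summable_exp_neg_mul_int_sq ha)

theorem exists_inv_sqrt_mul_tsum_le :
    ∃ c : ℝ, 0 < c ∧ ∀ s : ℝ, 0 < s →
      (√(4 * π * s))⁻¹ * ∑' n : ℤ, Real.exp (-(π ^ 2 / s) * (n : ℝ) ^ 2) ≤
        c * (1 + (√s)⁻¹) := by
  have hpos : ∀ a : ℝ, 0 ≤ ∑' n : ℤ, Real.exp (-a * (n : ℝ) ^ 2) := fun a =>
    tsum_nonneg fun n => (Real.exp_pos _).le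
  set A := ∑' n : ℤ, Real.exp (-(π ^ 2) * (n : ℝ) ^ 2)
  set B := ∑' n : ℤ, Real.exp (-1 * (n : ℝ) ^ 2)
  have hA : 0 ≤ A := hpos _
  have hB : 0 ≤ B := hpos _
  refine ⟨A + B + 1, by positivity, fun s hs => ?_⟩
  have hs' : 0 < √s := Real.sqrt_pos.2 hs
  have hπ := Real.pi_gt_three
  rcases le_total s 1 with h1 | h1
  · have h2 : ∑' n : ℤ, Real.exp (-(π ^ 2 / s) * (n : ℝ) ^ 2) ≤ A :=
      tsum_exp_neg_mul_int_sq_anti (by positivity) (le_div_self (by positivity) hs h1)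
    have h3 : (√(4 * π * s))⁻¹ ≤ (√s)⁻¹ := by
      gcongr
      nlinarith
    calc _ ≤ (√s)⁻¹ * A := by gcongr
      _ ≤ (A + B + 1) * (1 + (√s)⁻¹) := by
        have : 0 < (√s)⁻¹ := by positivity
        nlinarith
  · have h2 : ∑' n : ℤ, Real.exp (-s * (n : ℝ) ^ 2) ≤ B :=
      tsum_exp_neg_mul_int_sq_anti one_pos h1
    have h3 := Real.tsum_exp_neg_mul_int_sq (a := π / s) (by positivity)
    have e1 : -π * (π / s) = -(π ^ 2 / s) := by ring
    have e2 : -π / (π / s) = -s := by field_simp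
    rw [e1, e2, ← Real.sqrt_eq_rpow] at h3
    have h4 : (√(4 * π * s))⁻¹ * (1 / √(π / s)) = (2 * π)⁻¹ := by
      rw [one_div, ← mul_inv, ← Real.sqrt_mul (by positivity)]
      have : 4 * π * s * (π / s) = (2 * π) ^ 2 := by field_simp; ring
      rw [this, Real.sqrt_sq (by positivity)]
    rw [h3, ← mul_assoc, h4]
    have h5 : (2 * π)⁻¹ ≤ 1 := inv_le_one_of_one_le₀ (by linarith)
    calc _ ≤ 1 * B := by gcongr
      _ ≤ (A + B + 1) * (1 + (√s)⁻¹) := by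
        have : 0 < (√s)⁻¹ := by positivity
        nlinarith

/-- Periodizations of one-dimensional Gaussians are bounded. -/
theorem exists_tsum_gaussianPDF_le :
    ∃ c : ℝ, 0 < c ∧ ∀ s : ℝ, 0 < s → ∀ z ∈ Set.Ico 0 (2 * π),
      ∑' k : ℤ, ProbabilityTheory.gaussianPDF 0 (2 * s).toNNReal (2 * π * k + z) ≤
        ENNReal.ofReal (c * (1 + (√s)⁻¹)) := by
  obtain ⟨c, hc, h⟩ := exists_inv_sqrt_mul_tsum_le
  refine ⟨2 * c, by positivity, fun s hs z hz => ?_⟩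
  have hπ := Real.pi_pos
  set f : ℤ → ℝ := fun n => (√(4 * π * s))⁻¹ * Real.exp (-(π ^ 2 / s) * (n : ℝ) ^ 2) with hf
  have hfs : Summable f := (summable_exp_neg_mul_int_sq (by positivity)).mul_left _
  have hfs' : Summable fun n => f (n + 1) := (Equiv.addRight (1 : ℤ)).summable_iff.2 hfs
  have hf0 : ∀ n, 0 ≤ f n := fun n => by positivity
  have hft : ∑' n, f n ≤ c * (1 + (√s)⁻¹) := by
    rw [hf, tsum_mul_left]
    exact h s hs
  have key : ∀ y w : ℝ, 0 ≤ w → w ≤ |y| →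
      Real.exp (-y ^ 2 / (4 * s)) ≤ Real.exp (-w ^ 2 / (4 * s)) := by
    intro y w hw hwy
    have : w ^ 2 ≤ y ^ 2 := by rw [← sq_abs y]; gcongr
    gcongr
  have hk : ∀ k : ℤ, ProbabilityTheory.gaussianPDF 0 (2 * s).toNNReal (2 * π * k + z) ≤
      ENNReal.ofReal (f k + f (k + 1)) := by
    intro k
    refine ENNReal.ofReal_le_ofReal ?_
    rw [ProbabilityTheory.gaussianPDFReal, Real.coe_toNNReal _ (by positivity), sub_zero,
      show 2 * π * (2 * s) = 4 * π * s by ring, show 2 * (2 * s) = 4 * s by ring]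
    have e : ∀ n : ℤ, f n = (√(4 * π * s))⁻¹ * Real.exp (-(2 * π * n) ^ 2 / (4 * s)) := by
      intro n
      simp only [hf]
      congr 2
      field_simp
      ring
    rcases le_or_gt 0 k with hk | hk
    · refine le_trans ?_ (le_add_of_nonneg_right (hf0 _))
      rw [e]
      have : (0 : ℝ) ≤ k := by exact_mod_cast hk
      gcongr _ * ?_
      refine key _ _ (by positivity) (le_trans ?_ (le_abs_self _))
      linarith [hz.1]
    · refine le_trans ?_ (le_add_of_nonneg_left (hf0 _))
      rw [e]
      have : ((k + 1 : ℤ) : ℝ) ≤ 0 := by exact_mod_cast hk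
      gcongr _ * ?_
      rw [← neg_sq (2 * π * ((k + 1 : ℤ) : ℝ))]
      refine key _ _ (by nlinarith) (le_trans ?_ (neg_le_abs _))
      push_cast
      linarith [hz.2]
  calc _ ≤ ∑' k : ℤ, ENNReal.ofReal (f k + f (k + 1)) := ENNReal.tsum_le_tsum hk
    _ = ENNReal.ofReal (∑' k : ℤ, (f k + f (k + 1))) :=
      (ENNReal.ofReal_tsum_of_nonneg (fun k => add_nonneg (hf0 _) (hf0 _)) (hfs.add hfs')).symm
    _ ≤ _ := by
      refine ENNReal.ofReal_le_ofReal ?_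
      have e : ∑' k : ℤ, f (k + 1) = ∑' k, f k := (Equiv.addRight (1 : ℤ)).tsum_eq f
      rw [hfs.tsum_add hfs', e]
      linarith

/-- The heat kernel on `ℝ^d` at time `s`, as a density. -/
noncomputable def heatDensity (d : ℕ) (s : ℝ) (x : Fin d → ℝ) : ℝ≥0∞ :=
  ∏ i, ProbabilityTheory.gaussianPDF 0 (2 * s).toNNReal (x i)

theorem Measurable.heatDensity {α : Type*} [MeasurableSpace α] {d : ℕ} {f : α → ℝ}
    {g : α → Fin d → ℝ} (hf : Measurable f) (hg : Measurable g) :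
    Measurable fun a => heatDensity d (f a) (g a) := by
  refine Finset.measurable_fun_prod _ fun i _ => ?_
  simp only [ProbabilityTheory.gaussianPDF, ProbabilityTheory.gaussianPDFReal]
  fun_prop

/-- The heat kernel on `ℝ^d` at time `s`, as a measure. -/
noncomputable def heatMeasure (d : ℕ) (s : ℝ) : Measure (Fin d → ℝ) :=
  volume.withDensity (heatDensity d s)

theorem isProbabilityMeasure_heatMeasure (d : ℕ) {s : ℝ} (hs : 0 < s) :
    IsProbabilityMeasure (heatMeasure d s) := by
  constructor
  rw [heatMeasure, withDensity_apply _ .univ, setLIntegral_univ]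
  have := lintegral_fin_prod_eq_prod (d := d)
    (ProbabilityTheory.measurable_gaussianPDF 0 (2 * s).toNNReal)
  rw [ProbabilityTheory.lintegral_gaussianPDF_eq_one _ (by simpa using hs), one_pow] at this
  exact this

theorem Kker_eq (d : ℕ) {σ μ : ℝ} (hμ : 0 < μ) (x : Fin d → ℝ) :
    Kker d σ μ x = ∫⁻ t in Set.Ioi (0 : ℝ),
      ENNReal.ofReal (Real.exp (-t)) * heatDensity d (t * μ ^ ((2 : ℝ) / σ)) x := by
  refine setLIntegral_congr_fun measurableSet_Ioi fun t ht => ?_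
  have ht : 0 < t := ht
  set m := μ ^ ((2 : ℝ) / σ)
  have hm : 0 < m := Real.rpow_pos_of_pos hμ _
  simp only [heatDensity, ProbabilityTheory.gaussianPDF]
  rw [← ENNReal.ofReal_prod_of_nonneg fun i _ => ProbabilityTheory.gaussianPDFReal_nonneg _ _ _,
    ← ENNReal.ofReal_mul (Real.exp_pos _).le, mul_assoc]
  congr 2
  simp only [ProbabilityTheory.gaussianPDFReal]
  rw [Real.coe_toNNReal _ (by positivity), Finset.prod_mul_distrib, Finset.prod_const,
    ← Real.exp_sum, Finset.card_univ, Fintype.card_fin, ← Finset.sum_div]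
  have e1 : 2 * π * (2 * (t * m)) = 4 * π * t * m := by ring
  have e2 : 2 * (2 * (t * m)) = 4 * t * m := by ring
  rw [e1, e2]
  congr 1
  · rw [Real.sqrt_eq_rpow, ← Real.rpow_neg (by positivity), ← Real.rpow_natCast,
      ← Real.rpow_mul (by positivity)]
    congr 1
    ring
  · simp

theorem lintegral_heatMeasure (d : ℕ) (s : ℝ) {f : (Fin d → ℝ) → ℝ≥0∞} (hf : Measurable f) :
    ∫⁻ z, f z ∂heatMeasure d s = ∫⁻ z, heatDensity d s z * f z :=
  lintegral_withDensity_eq_lintegral_mul _ (measurable_const.heatDensity measurable_id) hf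

theorem lintegral_withDensity_lintegral {α β : Type*} [MeasurableSpace α] [MeasurableSpace β]
    {ν : Measure α} {τ : Measure β} [SFinite ν] [SFinite τ] {p : α → β → ℝ≥0∞}
    (hp : Measurable (Function.uncurry p)) {f : α → ℝ≥0∞} (hf : Measurable f) :
    ∫⁻ x, f x ∂ν.withDensity (fun x => ∫⁻ t, p x t ∂τ) = ∫⁻ t, ∫⁻ x, p x t * f x ∂ν ∂τ := by
  rw [lintegral_withDensity_eq_lintegral_mul _ hp.lintegral_prod_right hf,
    lintegral_lintegral_swap
      (by fun_prop : Measurable fun q : β × α => p q.2 q.1 * f q.2).aemeasurable]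
  exact lintegral_congr fun x => (lintegral_mul_const _ hp.of_uncurry_left).symm

theorem lintegral_Kmeas (d : ℕ) {σ μ : ℝ} (hμ : 0 < μ) {f : (Fin d → ℝ) → ℝ≥0∞}
    (hf : Measurable f) :
    ∫⁻ z, f z ∂Kmeas d σ μ = ∫⁻ t in Set.Ioi (0 : ℝ),
      ENNReal.ofReal (Real.exp (-t)) * ∫⁻ z, f z ∂heatMeasure d (t * μ ^ ((2 : ℝ) / σ)) := by
  rw [Kmeas, funext fun x => Kker_eq (σ := σ) d hμ x]
  generalize μ ^ ((2 : ℝ) / σ) = m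
  have hp : Measurable (Function.uncurry fun (x : Fin d → ℝ) (t : ℝ) =>
      ENNReal.ofReal (Real.exp (-t)) * heatDensity d (t * m) x) :=
    (by fun_prop : Measurable fun q : (Fin d → ℝ) × ℝ => ENNReal.ofReal (Real.exp (-q.2))).mul
      ((measurable_snd.mul_const m).heatDensity measurable_fst)
  refine (lintegral_withDensity_lintegral hp hf).trans (lintegral_congr fun t => ?_)
  have hst : Measurable (heatDensity d (t * m)) :=
    (measurable_const.heatDensity measurable_id)
  rw [lintegral_heatMeasure d _ hf, ← lintegral_const_mul _ (by fun_prop)]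
  exact lintegral_congr fun x => mul_assoc _ _ _

theorem isProbabilityMeasure_Kmeas (d : ℕ) {σ μ : ℝ} (hμ : 0 < μ) :
    IsProbabilityMeasure (Kmeas d σ μ) := by
  constructor
  rw [← lintegral_one, lintegral_Kmeas d hμ measurable_const]
  have h : ∀ t ∈ Set.Ioi (0 : ℝ), ENNReal.ofReal (Real.exp (-t)) *
      ∫⁻ _, 1 ∂heatMeasure d (t * μ ^ ((2 : ℝ) / σ)) =
        ENNReal.ofReal (Real.exp (-t)) := by
    intro t ht
    have := isProbabilityMeasure_heatMeasure d
      (mul_pos (Set.mem_Ioi.1 ht) (Real.rpow_pos_of_pos hμ (2 / σ)))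
    simp
  rw [setLIntegral_congr_fun measurableSet_Ioi h, ← ofReal_integral_eq_lintegral_ofReal
    (integrableOn_exp_neg_Ioi 0) (ae_of_all _ fun t => (Real.exp_pos _).le),
    integral_exp_neg_Ioi_zero, ENNReal.ofReal_one]

theorem isProbabilityMeasure_Kpow (d : ℕ) {σ μ : ℝ} (hμ : 0 < μ) (g : ℕ) :
    IsProbabilityMeasure (Kpow d σ μ g) := by
  have := isProbabilityMeasure_Kmeas d (σ := σ) hμ
  induction g with
  | zero => exact Measure.dirac.isProbabilityMeasure
  | succ g ih => exact Measure.probabilitymeasure_of_probabilitymeasures_conv _ _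

theorem lintegral_Kmeas_conv (d : ℕ) {σ μ : ℝ} (hμ : 0 < μ) (ρ : Measure (Fin d → ℝ)) [SFinite ρ]
    {f : (Fin d → ℝ) → ℝ≥0∞} (hf : Measurable f) :
    ∫⁻ z, f z ∂(Kmeas d σ μ).conv ρ = ∫⁻ t in Set.Ioi (0 : ℝ), ENNReal.ofReal (Real.exp (-t)) *
      ∫⁻ z, f z ∂(heatMeasure d (t * μ ^ ((2 : ℝ) / σ))).conv ρ := by
  have hg : Measurable fun y => ∫⁻ z, f (y + z) ∂ρ :=
    (by fun_prop : Measurable fun p : (Fin d → ℝ) × (Fin d → ℝ) =>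
      f (p.1 + p.2)).lintegral_prod_right'
  simp_rw [Measure.lintegral_conv hf]
  exact lintegral_Kmeas d hμ hg

/-- Convolution with `ν` maps `L¹` of the torus to `L^∞` with norm at most `M`. -/
def Ultracontractive {d : ℕ} (ν : Measure (Fin d → ℝ)) (M : ℝ≥0∞) : Prop :=
  ∀ h : (Fin d → ℝ) → ℝ≥0∞, Measurable h → LatticePeriodic h → ∀ x,
    ∫⁻ z, h (x - z) ∂ν ≤ M * ∫⁻ z in box d, h z

theorem Ultracontractive.conv_left {d : ℕ} {ν ρ : Measure (Fin d → ℝ)} {M : ℝ≥0∞}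
    [IsProbabilityMeasure ν] [SFinite ρ] (h : Ultracontractive ρ M) :
    Ultracontractive (ν.conv ρ) M := by
  intro f hf hp x
  rw [Measure.lintegral_conv (by fun_prop)]
  calc _ ≤ ∫⁻ _, (M * ∫⁻ z in box d, f z) ∂ν := by
        refine lintegral_mono fun y => ?_
        simp_rw [← sub_sub]
        exact h f hf hp (x - y)
    _ = _ := by simp

theorem Ultracontractive.conv_right {d : ℕ} {ν ρ : Measure (Fin d → ℝ)} {M : ℝ≥0∞}
    [IsProbabilityMeasure ρ] [SFinite ν] (h : Ultracontractive ν M) :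
    Ultracontractive (ν.conv ρ) M := by
  rw [Measure.conv_comm]
  exact h.conv_left

theorem Ultracontractive.Kmeas_conv {d : ℕ} {σ μ : ℝ} (hμ : 0 < μ) {ρ : Measure (Fin d → ℝ)}
    [SFinite ρ] {M : ℝ → ℝ≥0∞} (hM : Measurable M)
    (h : ∀ t, 0 < t →
      Ultracontractive ((heatMeasure d (t * μ ^ ((2 : ℝ) / σ))).conv ρ) (M t)) :
    Ultracontractive ((Kmeas d σ μ).conv ρ)
      (∫⁻ t in Set.Ioi (0 : ℝ), ENNReal.ofReal (Real.exp (-t)) * M t) := by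
  intro f hf hp x
  rw [lintegral_Kmeas_conv d hμ ρ (by fun_prop), ← lintegral_mul_const _ (by fun_prop)]
  refine setLIntegral_mono (by fun_prop) fun t ht => ?_
  rw [mul_assoc]
  gcongr
  exact h t ht f hf hp x

theorem exists_ultracontractive_heatMeasure (d : ℕ) :
    ∃ c : ℝ, 0 < c ∧ ∀ s : ℝ, 0 < s →
      Ultracontractive (heatMeasure d s) (ENNReal.ofReal (c * (1 + (√s)⁻¹)) ^ d) := by
  obtain ⟨c, hc, h⟩ := exists_tsum_gaussianPDF_le
  refine ⟨c, hc, fun s hs f hf hp x => ?_⟩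
  rw [lintegral_heatMeasure d s (by fun_prop)]
  refine hp.lintegral_mul_le hf (measurable_const.heatDensity measurable_id)
    (fun z hz => ?_) x
  calc _ = ∏ i, ∑' k : ℤ, ProbabilityTheory.gaussianPDF 0 (2 * s).toNNReal (2 * π * k + z i) :=
        tsum_fin_prod_eq_prod fun i k =>
          ProbabilityTheory.gaussianPDF 0 (2 * s).toNNReal (2 * π * k + z i)
    _ ≤ ∏ _i : Fin d, ENNReal.ofReal (c * (1 + (√s)⁻¹)) :=
        Finset.prod_le_prod' fun i _ => h s hs _ (hz i (Set.mem_univ i))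
    _ = _ := by simp

theorem Ultracontractive.conv_Kpow {d : ℕ} {σ μ : ℝ} (hμ : 0 < μ) {b : ℝ → ℝ≥0∞}
    (hb : Measurable b)
    (h : ∀ t, 0 < t → Ultracontractive (heatMeasure d (t * μ ^ ((2 : ℝ) / σ))) (b t ^ d))
    {g : ℕ} (hg : g ≤ d) {ν : Measure (Fin d → ℝ)} [IsProbabilityMeasure ν] {B : ℝ≥0∞}
    (hν : Ultracontractive ν (B ^ d)) :
    Ultracontractive (ν.conv (Kpow d σ μ g))
      ((∫⁻ t in Set.Ioi (0 : ℝ), ENNReal.ofReal (Real.exp (-t)) * b t) ^ g * B ^ (d - g)) := by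
  have := isProbabilityMeasure_Kmeas d (σ := σ) hμ
  set D := ∫⁻ t in Set.Ioi (0 : ℝ), ENNReal.ofReal (Real.exp (-t)) * b t
  induction g generalizing ν B with
  | zero => simpa [Kpow] using hν
  | succ g ih =>
    have := isProbabilityMeasure_Kpow d (σ := σ) hμ g
    have e : ν.conv (Kpow d σ μ (g + 1)) = (Kmeas d σ μ).conv (ν.conv (Kpow d σ μ g)) := by
      rw [Kpow, ← Measure.conv_assoc, Measure.conv_comm ν, Measure.conv_assoc]
    have eD : D ^ (g + 1) * B ^ (d - (g + 1)) = ∫⁻ t in Set.Ioi (0 : ℝ),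
        ENNReal.ofReal (Real.exp (-t)) * (D ^ g * (b t * B ^ (d - (g + 1)))) := by
      rw [pow_succ, mul_assoc, ← lintegral_mul_const _ (by fun_prop),
        ← lintegral_const_mul _ (by fun_prop)]
      refine lintegral_congr fun t => by ring
    rw [e, eD]
    refine Ultracontractive.Kmeas_conv hμ (by fun_prop) fun t ht => ?_
    have := isProbabilityMeasure_heatMeasure d (mul_pos ht (Real.rpow_pos_of_pos hμ (2 / σ)))
    rw [← Measure.conv_assoc]
    have hmin : Ultracontractive ((heatMeasure d (t * μ ^ ((2 : ℝ) / σ))).conv ν)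
        (min (b t) B ^ d) := by
      rcases le_total (b t) B with hle | hle
      · rw [min_eq_left hle]
        exact (h t ht).conv_right
      · rw [min_eq_right hle]
        exact hν.conv_left
    intro f hf hp x
    refine (ih (by omega) hmin f hf hp x).trans ?_
    gcongr
    rw [show d - g = d - (g + 1) + 1 by omega, pow_succ']
    gcongr
    · exact min_le_left _ _
    · exact min_le_right _ _

theorem enorm_integral_pow_le {α : Type*} [MeasurableSpace α] {ν : Measure α}
    [IsProbabilityMeasure ν] {f : α → ℝ} (hf : AEStronglyMeasurable f ν) {n : ℕ} (hn : 0 < n) :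
    ‖∫ x, f x ∂ν‖ₑ ^ n ≤ ∫⁻ x, ‖f x‖ₑ ^ n ∂ν := by
  have hn' : (0 : ℝ) < n := by exact_mod_cast hn
  have h := eLpNorm'_le_eLpNorm'_of_exponent_le one_pos
    (by exact_mod_cast hn : (1 : ℝ) ≤ n) ν hf
  simp only [eLpNorm', ENNReal.rpow_one, div_one, ENNReal.rpow_natCast] at h
  calc ‖∫ x, f x ∂ν‖ₑ ^ n ≤ ((∫⁻ x, ‖f x‖ₑ ^ n ∂ν) ^ (1 / (n : ℝ))) ^ n := by
        gcongr
        exact (enorm_integral_le_lintegral_enorm f).trans h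
    _ = _ := by
        rw [← ENNReal.rpow_natCast, ← ENNReal.rpow_mul, one_div_mul_cancel hn'.ne',
          ENNReal.rpow_one]

theorem lintegral_exp_neg_mul_one_add_inv_sqrt_lt_top :
    ∫⁻ t in Set.Ioi (0 : ℝ), ENNReal.ofReal (Real.exp (-t) * (1 + (√t)⁻¹)) < ∞ := by
  have h := (integrableOn_exp_neg_Ioi 0).add
    (Real.GammaIntegral_convergent (s := 1 / 2) (by norm_num))
  refine lt_of_eq_of_lt (setLIntegral_congr_fun measurableSet_Ioi fun t ht => ?_)
    h.lintegral_lt_top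
  have ht : 0 < t := ht
  simp only [Pi.add_apply]
  rw [Real.sqrt_eq_rpow, ← Real.rpow_neg ht.le, mul_add, mul_one]
  norm_num

/-- The `L¹ → L^∞` norm of the `d`-th convolution power of `K_μ` on the torus. -/
theorem exists_ultracontractive_Kpow {d : ℕ} (hd : 1 ≤ d) {σ : ℝ} (hσ : 0 < σ) :
    ∃ C : ℝ, 0 < C ∧ ∀ μ : ℝ, 0 < μ → μ ≤ 1 →
      Ultracontractive (Kpow d σ μ d) (ENNReal.ofReal (C * μ ^ (-(d : ℝ) / σ))) := by
  obtain ⟨c, hc, h⟩ := exists_ultracontractive_heatMeasure d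
  set J := ∫⁻ t in Set.Ioi (0 : ℝ), ENNReal.ofReal (Real.exp (-t) * (1 + (√t)⁻¹))
  have hJ : J < ∞ := lintegral_exp_neg_mul_one_add_inv_sqrt_lt_top
  refine ⟨(c * (J.toReal + 1)) ^ d, by positivity, fun μ hμ hμ1 => ?_⟩
  set b : ℝ → ℝ≥0∞ := fun t => ENNReal.ofReal (c * (1 + (√(t * μ ^ ((2 : ℝ) / σ)))⁻¹))
  have hb : Measurable b := by fun_prop
  have hm : ∀ t : ℝ, 0 < t → 0 < t * μ ^ ((2 : ℝ) / σ) := fun t ht =>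
    mul_pos ht (Real.rpow_pos_of_pos hμ _)
  have hbt : ∀ t, 0 < t →
      Ultracontractive (heatMeasure d (t * μ ^ ((2 : ℝ) / σ))) (b t ^ d) :=
    fun t ht => h _ (hm t ht)
  set D := ∫⁻ t in Set.Ioi (0 : ℝ), ENNReal.ofReal (Real.exp (-t)) * b t with hD
  have hDle : D ≤ ENNReal.ofReal (c * (J.toReal + 1) * μ ^ (-1 / σ)) := by
    have hμσ : 1 ≤ μ ^ (-1 / σ) :=
      Real.one_le_rpow_of_pos_of_le_one_of_nonpos hμ hμ1
        (div_nonpos_of_nonpos_of_nonneg (by norm_num) hσ.le)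
    have hbound : ∀ t ∈ Set.Ioi (0 : ℝ), ENNReal.ofReal (Real.exp (-t)) * b t ≤
        ENNReal.ofReal (c * μ ^ (-1 / σ)) * ENNReal.ofReal (Real.exp (-t) * (1 + (√t)⁻¹)) := by
      intro t ht
      have ht : 0 < t := ht
      rw [← ENNReal.ofReal_mul (Real.exp_pos _).le, ← ENNReal.ofReal_mul (by positivity)]
      refine ENNReal.ofReal_le_ofReal ?_
      have e : (√(t * μ ^ ((2 : ℝ) / σ)))⁻¹ = (√t)⁻¹ * μ ^ (-1 / σ) := by
        rw [Real.sqrt_mul ht.le, mul_inv, Real.sqrt_eq_rpow (μ ^ _), ← Real.rpow_mul hμ.le,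
          ← Real.rpow_neg hμ.le]
        congr 2
        ring
      rw [e]
      have : Real.exp (-t) * c * (1 + (√t)⁻¹ * μ ^ (-1 / σ)) ≤
          Real.exp (-t) * c * (μ ^ (-1 / σ) + (√t)⁻¹ * μ ^ (-1 / σ)) := by gcongr
      linarith
    calc D ≤ ∫⁻ t in Set.Ioi (0 : ℝ), ENNReal.ofReal (c * μ ^ (-1 / σ)) *
          ENNReal.ofReal (Real.exp (-t) * (1 + (√t)⁻¹)) :=
          setLIntegral_mono (by fun_prop) hbound
      _ = ENNReal.ofReal (c * μ ^ (-1 / σ)) * ENNReal.ofReal J.toReal := by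
          rw [lintegral_const_mul _ (by fun_prop), ENNReal.ofReal_toReal hJ.ne]
      _ ≤ _ := by
          rw [← ENNReal.ofReal_mul (by positivity)]
          refine ENNReal.ofReal_le_ofReal ?_
          have : 0 < c * μ ^ (-1 / σ) := by positivity
          nlinarith
  have hK : Ultracontractive (Kpow d σ μ d) (D ^ d) := by
    obtain ⟨g, rfl⟩ := Nat.exists_eq_add_of_le' hd
    have := isProbabilityMeasure_Kpow (g + 1) (σ := σ) hμ g
    have e : D ^ (g + 1) = ∫⁻ t in Set.Ioi (0 : ℝ),
        ENNReal.ofReal (Real.exp (-t)) * (D ^ g * b t) := by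
      rw [pow_succ]
      conv_lhs => rw [hD]
      rw [← lintegral_const_mul _ (by fun_prop)]
      exact lintegral_congr fun t => mul_left_comm _ _ _
    rw [e, Kpow]
    refine Ultracontractive.Kmeas_conv hμ (by fun_prop) fun t ht => ?_
    have := isProbabilityMeasure_heatMeasure (g + 1) (hm t ht)
    simpa using Ultracontractive.conv_Kpow hμ hb hbt (Nat.le_succ g) (hbt t ht)
  intro f hf hp x
  refine (hK f hf hp x).trans ?_
  gcongr
  calc D ^ d ≤ ENNReal.ofReal (c * (J.toReal + 1) * μ ^ (-1 / σ)) ^ d := by gcongr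
    _ = _ := by
      rw [← ENNReal.ofReal_pow (by positivity), mul_pow, ← Real.rpow_mul_natCast hμ.le]
      congr 3
      ring

/-- for even `n` there is `C = C(d,σ,n) > 0` such that for every
probability space, every (jointly measurable) random `2π`-periodic field `ζ`
(identified with a random element of `L^n(𝕋)`) and every `μ ∈ (0,1/2]`,
`𝔼‖(𝐓K_μ^{*d}) ⋆ ζ‖_{L^∞(𝕋)}^n ≤ C [μ]^{−d} 𝔼‖ζ‖_{L^n(𝕋)}^n`. -/
theorem stmt10 (d : ℕ) (hd : 1 ≤ d) (σ : ℝ) (hσ : 0 < σ) (n : ℕ) (hn : Even n) (hn0 : 0 < n) :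
    ∃ C : ℝ, 0 < C ∧ ∀ (Ω : Type) (_ : MeasureSpace Ω)
      (_ : IsProbabilityMeasure (volume : Measure Ω))
      (ζ : Ω → (Fin d → ℝ) → ℝ),
      Measurable (Function.uncurry ζ) →
      (∀ (ω : Ω) (x : Fin d → ℝ) (k : Fin d → ℤ),
        ζ ω (x + fun i => 2 * π * (k i : ℝ)) = ζ ω x) →
      ∀ μ : ℝ, μ ∈ Set.Ioc (0 : ℝ) (1 / 2) →
        (∫⁻ ω : Ω,
            (essSup (fun x => (‖measConv d (Kpow d σ μ d) (ζ ω) x‖₊ : ℝ≥0∞))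
              (volume.restrict (box d))) ^ n) ≤
          ENNReal.ofReal (C * μ ^ (-(d : ℝ) / σ)) *
            ∫⁻ ω : Ω, ∫⁻ x in box d, (‖ζ ω x‖₊ : ℝ≥0∞) ^ n := by
  obtain ⟨C, hC, h⟩ := exists_ultracontractive_Kpow hd hσ
  refine ⟨C, hC, fun Ω _ _ ζ hζ hper μ hμ => ?_⟩
  have := isProbabilityMeasure_Kpow d (σ := σ) hμ.1 d
  rw [← lintegral_const_mul' _ _ ENNReal.ofReal_ne_top]
  refine lintegral_mono fun ω => ?_
  have hm : Measurable (ζ ω) := hζ.of_uncurry_left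
  have hp : LatticePeriodic fun x => ‖ζ ω x‖ₑ ^ n := fun x k => by
    change ‖ζ ω (x + fun i => 2 * π * (k i : ℝ))‖ₑ ^ n = _
    rw [hper]
  have hn' : (n : ℝ) ≠ 0 := by exact_mod_cast hn0.ne'
  set I := ENNReal.ofReal (C * μ ^ (-(d : ℝ) / σ)) * ∫⁻ x in box d, ‖ζ ω x‖ₑ ^ n
  have hpt : ∀ x, ‖measConv d (Kpow d σ μ d) (ζ ω) x‖ₑ ≤ I ^ ((n : ℝ)⁻¹) := by
    intro x
    rw [ENNReal.le_rpow_inv_iff (by positivity), ENNReal.rpow_natCast]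
    exact (enorm_integral_pow_le
      (hm.comp (measurable_const.sub measurable_id)).aestronglyMeasurable hn0).trans
      (h μ hμ.1 (hμ.2.trans (by norm_num)) _ (by fun_prop) hp x)
  calc _ ≤ (I ^ ((n : ℝ)⁻¹)) ^ n := by
        gcongr
        exact essSup_le_of_ae_le _ (ae_of_all _ hpt)
    _ = I := by rw [← ENNReal.rpow_natCast, ENNReal.rpow_inv_rpow hn']
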